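/- arXiv:1906.04827 — 3 statements merged into one kernel-verified Lean document; each statement's English description precedes it below -/
import Mathlib

section
/- Define H(b) = (3b² − 6b + 2)³/(b²(3b+2)²) for b > 0. Then the set {b ∈ (0,∞) : H′(b) = 0} consists of exactly three points: (3−√3)/3, (3+√3)/3, and the unique root b₀ ∈ (0,∞) of the cubic 9b³ + 21b² − 18b − 4, which satisfies 0.80 < b₀ < 0.82. -/
/-- The derivative of `(3b² − 6b + 2)³/(b²(3b+2)²)` in factored form. -/
theorem hasDerivAt_cube_div_sq {b : ℝ} (hb : 0 < b) :
    HasDerivAt (fun x : ℝ => (3 * x ^ 2 - 6 * x + 2) ^ 3 / (x ^ 2 * (3 * x + 2) ^ 2))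
      (2 * (3 * b ^ 2 - 6 * b + 2) ^ 2 * (9 * b ^ 3 + 21 * b ^ 2 - 18 * b - 4)
        / (b * (3 * b + 2)) ^ 3) b := by
  have hid := hasDerivAt_id' b
  have hnum := ((((hid.pow 2).const_mul 3).sub (hid.const_mul 6)).add_const 2).pow 3
  have hden := (hid.pow 2).mul (((hid.const_mul 3).add_const 2).pow 2)
  have hlin : 3 * b + 2 ≠ 0 := by positivity
  have hden0 : b ^ 2 * (3 * b + 2) ^ 2 ≠ 0 := by positivity
  refine (hnum.div hden hden0).congr_deriv ?_
  simp only [Pi.mul_apply, Pi.pow_apply, Pi.sub_apply]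
  field_simp
  ring

/-- The cubic `9b³ + 21b² − 18b − 4` has at most one positive root. -/
theorem cubic_pos_root_unique {a b : ℝ} (ha : 0 < a) (hb : 0 < b)
    (hpa : 9 * a ^ 3 + 21 * a ^ 2 - 18 * a - 4 = 0)
    (hpb : 9 * b ^ 3 + 21 * b ^ 2 - 18 * b - 4 = 0) : a = b := by
  have hprod : (a - b) * (9 * (a * b) * (a + b) + 21 * (a * b) + 4) = 0 := by
    linear_combination b * hpa - a * hpb
  have hpos : 9 * (a * b) * (a + b) + 21 * (a * b) + 4 ≠ 0 := by positivity
  exact sub_eq_zero.mp ((mul_eq_zero.mp hprod).resolve_right hpos)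

theorem quadratic_eq_zero_iff_sqrt_three (b : ℝ) :
    3 * b ^ 2 - 6 * b + 2 = 0 ↔ b = (3 - Real.sqrt 3) / 3 ∨ b = (3 + Real.sqrt 3) / 3 := by
  have hs : Real.sqrt 3 ^ 2 = 3 := Real.sq_sqrt (by norm_num)
  have hfac : 3 * b ^ 2 - 6 * b + 2
      = 3 * ((b - (3 - Real.sqrt 3) / 3) * (b - (3 + Real.sqrt 3) / 3)) := by
    linear_combination (1 / 3) * hs
  rw [hfac, mul_eq_zero, mul_eq_zero, sub_eq_zero, sub_eq_zero]
  norm_num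

/-- For `H(b) = (3b² − 6b + 2)³/(b²(3b+2)²)` on `(0,∞)`, the critical set of `H`
in `(0,∞)` is exactly `{(3−√3)/3, (3+√3)/3, b₀}` where `b₀` is the unique positive
root of `9b³ + 21b² − 18b − 4`, and `0.80 < b₀ < 0.82`. -/
theorem stmt_8 (H : ℝ → ℝ)
    (hH : ∀ b, H b = (3 * b ^ 2 - 6 * b + 2) ^ 3 / (b ^ 2 * (3 * b + 2) ^ 2)) :
    ∃ b₀ : ℝ, 0 < b₀ ∧ 9 * b₀ ^ 3 + 21 * b₀ ^ 2 - 18 * b₀ - 4 = 0 ∧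
      (∀ b : ℝ, 0 < b → 9 * b ^ 3 + 21 * b ^ 2 - 18 * b - 4 = 0 → b = b₀) ∧
      (0.80 : ℝ) < b₀ ∧ b₀ < 0.82 ∧
      {b : ℝ | 0 < b ∧ deriv H b = 0}
        = {(3 - Real.sqrt 3) / 3, (3 + Real.sqrt 3) / 3, b₀} := by
  have hcont : ContinuousOn (fun b : ℝ => 9 * b ^ 3 + 21 * b ^ 2 - 18 * b - 4)
      (Set.Icc 0.80 0.82) := by fun_prop
  obtain ⟨b₀, ⟨hlo, hhi⟩, hroot⟩ :=
    intermediate_value_Ioo (by norm_num) hcont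
      (show (0 : ℝ) ∈ Set.Ioo _ _ by constructor <;> norm_num)
  have hpos : 0 < b₀ := lt_trans (by norm_num) hlo
  have hderiv {b : ℝ} (hb : 0 < b) : deriv H b = 0 ↔
      3 * b ^ 2 - 6 * b + 2 = 0 ∨ 9 * b ^ 3 + 21 * b ^ 2 - 18 * b - 4 = 0 := by
    have hden : (b * (3 * b + 2)) ^ 3 ≠ 0 := by positivity
    rw [funext hH, (hasDerivAt_cube_div_sq hb).deriv, div_eq_zero_iff, or_iff_left hden,
      mul_eq_zero, mul_eq_zero, or_iff_right two_ne_zero, pow_eq_zero_iff two_ne_zero]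
  refine ⟨b₀, hpos, hroot, fun b hb h => cubic_pos_root_unique hb hpos h hroot, hlo, hhi, ?_⟩
  ext b
  simp only [Set.mem_ofPred_eq, Set.mem_insert_iff, Set.mem_singleton_iff]
  rw [← or_assoc, ← quadratic_eq_zero_iff_sqrt_three]
  constructor
  · rintro ⟨hb, h⟩
    exact ((hderiv hb).mp h).imp_right fun h => cubic_pos_root_unique hb hpos h hroot
  · rintro (h | rfl)
    · have hb : 0 < b := by nlinarith [sq_nonneg b]
      exact ⟨hb, (hderiv hb).mpr (Or.inl h)⟩
    · exact ⟨hpos, (hderiv hpos).mpr (Or.inr hroot)⟩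
end

section
/- Define H(b) = (3b² − 38b + 2)³/(b²(3b+2)²) for b > 0. Then the set {b ∈ (0,∞) : H′(b) = 0} consists of exactly three points: (19−√355)/3, (19+√355)/3, and the unique root b₀ ∈ (0,∞) of the cubic 9b³ + 69b² − 50b − 4, which satisfies 0.73 < b₀ < 0.74. Moreover, H attains its global minimum on (0,∞) at b₀. -/
theorem cubic_eq_mul_of_root {b₀ : ℝ} (h : 9 * b₀ ^ 3 + 69 * b₀ ^ 2 - 50 * b₀ - 4 = 0) (b : ℝ) :
    9 * b ^ 3 + 69 * b ^ 2 - 50 * b - 4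
      = (b - b₀) * (9 * b ^ 2 + (69 + 9 * b₀) * b + (9 * b₀ ^ 2 + 69 * b₀ - 50)) := by
  linear_combination h

theorem quotient_pos_of_root {b₀ b : ℝ} (h₀ : 0 < b₀)
    (h : 9 * b₀ ^ 3 + 69 * b₀ ^ 2 - 50 * b₀ - 4 = 0) (hb : 0 < b) :
    0 < 9 * b ^ 2 + (69 + 9 * b₀) * b + (9 * b₀ ^ 2 + 69 * b₀ - 50) := by
  have hc : 0 < 9 * b₀ ^ 2 + 69 * b₀ - 50 :=
    pos_of_mul_pos_right (a := b₀) (by linarith) h₀.le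
  positivity

theorem exists_cubic_root_mem_Ioo :
    ∃ b₀ ∈ Set.Ioo (0.73 : ℝ) 0.74, 9 * b₀ ^ 3 + 69 * b₀ ^ 2 - 50 * b₀ - 4 = 0 := by
  have hc : ContinuousOn (fun b : ℝ => 9 * b ^ 3 + 69 * b ^ 2 - 50 * b - 4)
      (Set.Icc 0.73 0.74) := by fun_prop
  exact intermediate_value_Ioo (by norm_num) hc ⟨by norm_num, by norm_num⟩

theorem hasDerivAt_einsteinHilbert {b : ℝ} (hb : 0 < b) :
    HasDerivAt (fun b : ℝ => (3 * b ^ 2 - 38 * b + 2) ^ 3 / (b ^ 2 * (3 * b + 2) ^ 2))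
      (2 * (3 * b ^ 2 - 38 * b + 2) ^ 2 * (9 * b ^ 3 + 69 * b ^ 2 - 50 * b - 4)
        / (b ^ 3 * (3 * b + 2) ^ 3)) b := by
  have hN : HasDerivAt (fun b : ℝ => 3 * b ^ 2 - 38 * b + 2) (6 * b - 38) b := by
    refine ((((hasDerivAt_id b).pow 2).const_mul 3).sub
      ((hasDerivAt_id b).const_mul 38) |>.add_const 2).congr_deriv ?_
    simp; ring
  have hL : HasDerivAt (fun b : ℝ => 3 * b + 2) 3 b := by
    simpa using ((hasDerivAt_id b).const_mul 3).add_const 2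
  have hne : b ^ 2 * (3 * b + 2) ^ 2 ≠ 0 := by positivity
  refine ((hN.pow 3).div (((hasDerivAt_id b).pow 2).mul (hL.pow 2)) hne).congr_deriv ?_
  have h2 : 3 * b + 2 ≠ 0 := by positivity
  simp
  field_simp
  ring

theorem numerator_eq_zero_iff (b : ℝ) :
    3 * b ^ 2 - 38 * b + 2 = 0 ↔ b = (19 - √355) / 3 ∨ b = (19 + √355) / 3 := by
  have hs : √355 ^ 2 = (355 : ℝ) := Real.sq_sqrt (by norm_num)
  have hf : 3 * b ^ 2 - 38 * b + 2 = 3 * ((b - (19 - √355) / 3) * (b - (19 + √355) / 3)) := by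
    linear_combination (1 / 3) * hs
  rw [hf]
  simp [sub_eq_zero]


/-- For `H(b) = (3b² − 38b + 2)³/(b²(3b+2)²)` on `(0,∞)`, the critical set of `H`
in `(0,∞)` is exactly `{(19−√355)/3, (19+√355)/3, b₀}` where `b₀` is the unique
positive root of `9b³ + 69b² − 50b − 4`, which satisfies `0.73 < b₀ < 0.74`; moreover
`H` attains its global minimum on `(0,∞)` at `b₀`. -/
theorem stmt_15 (H : ℝ → ℝ)
    (hH : ∀ b, H b = (3 * b ^ 2 - 38 * b + 2) ^ 3 / (b ^ 2 * (3 * b + 2) ^ 2)) :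
    ∃ b₀ : ℝ, 0 < b₀ ∧ 9 * b₀ ^ 3 + 69 * b₀ ^ 2 - 50 * b₀ - 4 = 0 ∧
      (∀ b : ℝ, 0 < b → 9 * b ^ 3 + 69 * b ^ 2 - 50 * b - 4 = 0 → b = b₀) ∧
      (0.73 : ℝ) < b₀ ∧ b₀ < 0.74 ∧
      {b : ℝ | 0 < b ∧ deriv H b = 0}
        = {(19 - Real.sqrt 355) / 3, (19 + Real.sqrt 355) / 3, b₀} ∧
      (∀ b : ℝ, 0 < b → H b₀ ≤ H b) := by
  obtain rfl : H = _ := funext hH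
  obtain ⟨b₀, ⟨hlo, hhi⟩, hroot⟩ := exists_cubic_root_mem_Ioo
  have h₀ : 0 < b₀ := by linarith
  have hQ {b : ℝ} (hb : 0 < b) := quotient_pos_of_root h₀ hroot hb
  have huniq (b : ℝ) (hb : 0 < b) (h : 9 * b ^ 3 + 69 * b ^ 2 - 50 * b - 4 = 0) : b = b₀ := by
    rw [cubic_eq_mul_of_root hroot, mul_eq_zero, or_iff_left (hQ hb).ne'] at h
    linarith
  refine ⟨b₀, h₀, hroot, huniq, hlo, hhi, ?_, ?_⟩
  · ext b
    simp only [Set.mem_ofPred_eq, Set.mem_insert_iff, Set.mem_singleton_iff]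
    have hcrit (hb : 0 < b) : deriv
        (fun b : ℝ => (3 * b ^ 2 - 38 * b + 2) ^ 3 / (b ^ 2 * (3 * b + 2) ^ 2)) b = 0 ↔
        3 * b ^ 2 - 38 * b + 2 = 0 ∨ 9 * b ^ 3 + 69 * b ^ 2 - 50 * b - 4 = 0 := by
      have hne : b ^ 3 * (3 * b + 2) ^ 3 ≠ 0 := by positivity
      rw [(hasDerivAt_einsteinHilbert hb).deriv, div_eq_zero_iff, or_iff_left hne]
      simp
    have hs : √355 < 19 := by
      rw [Real.sqrt_lt' (by norm_num)]
      norm_num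
    constructor
    · rintro ⟨hb, hd⟩
      rcases (hcrit hb).1 hd with h | h
      · rcases (numerator_eq_zero_iff b).1 h with h | h <;> simp [h]
      · exact Or.inr (Or.inr (huniq b hb h))
    · rintro (h | h | h)
      · have hb : 0 < b := by rw [h]; linarith
        exact ⟨hb, (hcrit hb).2 (Or.inl ((numerator_eq_zero_iff b).2 (Or.inl h)))⟩
      · have hb : 0 < b := by rw [h]; positivity
        exact ⟨hb, (hcrit hb).2 (Or.inl ((numerator_eq_zero_iff b).2 (Or.inr h)))⟩
      · subst h
        exact ⟨h₀, (hcrit h₀).2 (Or.inr hroot)⟩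
  · intro b hb
    rcases le_total b b₀ with hle | hle
    · refine antitoneOn_of_deriv_nonpos (convex_Icc b b₀)
        (fun x hx => (hasDerivAt_einsteinHilbert
          (hb.trans_le hx.1)).continuousAt.continuousWithinAt)
        (fun x hx => (hasDerivAt_einsteinHilbert
          (hb.trans_le (interior_subset hx).1)).differentiableAt.differentiableWithinAt)
        (fun x hx => ?_) (Set.left_mem_Icc.2 hle) (Set.right_mem_Icc.2 hle) hle
      have hx' := interior_subset hx
      have hx₀ : 0 < x := hb.trans_le hx'.1
      rw [(hasDerivAt_einsteinHilbert hx₀).deriv, cubic_eq_mul_of_root hroot]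
      exact div_nonpos_of_nonpos_of_nonneg (mul_nonpos_of_nonneg_of_nonpos (by positivity)
        (mul_nonpos_of_nonpos_of_nonneg (sub_nonpos.2 hx'.2) (hQ hx₀).le)) (by positivity)
    · refine monotoneOn_of_deriv_nonneg (convex_Icc b₀ b)
        (fun x hx => (hasDerivAt_einsteinHilbert
          (h₀.trans_le hx.1)).continuousAt.continuousWithinAt)
        (fun x hx => (hasDerivAt_einsteinHilbert
          (h₀.trans_le (interior_subset hx).1)).differentiableAt.differentiableWithinAt)
        (fun x hx => ?_) (Set.left_mem_Icc.2 hle) (Set.right_mem_Icc.2 hle) hle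
      have hx' := interior_subset hx
      have hx₀ : 0 < x := h₀.trans_le hx'.1
      rw [(hasDerivAt_einsteinHilbert hx₀).deriv, cubic_eq_mul_of_root hroot]
      exact div_nonneg (mul_nonneg (by positivity)
        (mul_nonneg (sub_nonneg.2 hx'.1) (hQ hx₀).le)) (by positivity)
end

section
/- Define SE(b) = (27b⁵ + 54b⁴ + 1674b³ + 964b² + 36b + 8)³/(b⁴(3b+2)(9b²+24b+4)³) for b > 0. Then the set {b ∈ (0,∞) : SE′(b) = 0} has exactly three elements: one in (0.44, 0.45), one in (0.73, 0.74), and one in (2.49, 2.50). The critical point in (0.73, 0.74) is a local maximum of SE, the other two are local minima, and the critical point in (2.49, 2.50) is the global minimum of SE on (0,∞). -/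
open Set

/-- The Sasaki energy, as a rational function of the slope of the ray. -/
noncomputable def sasakiEnergy (b : ℝ) : ℝ :=
  (27 * b ^ 5 + 54 * b ^ 4 + 1674 * b ^ 3 + 964 * b ^ 2 + 36 * b + 8) ^ 3
    / (b ^ 4 * (3 * b + 2) * (9 * b ^ 2 + 24 * b + 4) ^ 3)

/-- The polynomial whose sign is that of the derivative of `sasakiEnergy` on `(0,∞)`. -/
def critPoly (b : ℝ) : ℝ :=
  2916 * b ^ 8 + 17496 * b ^ 7 - 59292 * b ^ 6 - 19872 * b ^ 5 + 28512 * b ^ 4 + 12384 * b ^ 3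
    + 1600 * b ^ 2 - 3456 * b - 256

/-- The derivative of `critPoly`. -/
def critPolyDeriv (b : ℝ) : ℝ :=
  23328 * b ^ 7 + 122472 * b ^ 6 - 355752 * b ^ 5 - 99360 * b ^ 4 + 114048 * b ^ 3 + 37152 * b ^ 2
    + 3200 * b - 3456

theorem hasDerivAt_critPoly (b : ℝ) : HasDerivAt critPoly (critPolyDeriv b) b := by
  have h (c : ℝ) (n : ℕ) : HasDerivAt (fun x : ℝ => c * x ^ n) (c * (n * b ^ (n - 1))) b :=
    (hasDerivAt_pow n b).const_mul c
  have h₁ : HasDerivAt (fun x : ℝ => 3456 * x) 3456 b := by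
    simpa using (hasDerivAt_id b).const_mul (3456 : ℝ)
  refine (((((((((h 2916 8).add (h 17496 7)).sub (h 59292 6)).sub (h 19872 5)).add
    (h 28512 4)).add (h 12384 3)).add (h 1600 2)).sub h₁).sub_const 256).congr_deriv ?_
  rw [critPolyDeriv]
  norm_num
  ring

theorem continuous_critPoly : Continuous critPoly :=
  continuous_iff_continuousAt.2 fun b => (hasDerivAt_critPoly b).continuousAt

theorem hasDerivAt_sasakiEnergy {b : ℝ} (hb : 0 < b) :
    HasDerivAt sasakiEnergy
      ((27 * b ^ 5 + 54 * b ^ 4 + 1674 * b ^ 3 + 964 * b ^ 2 + 36 * b + 8) ^ 2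
        / (b ^ 5 * (3 * b + 2) ^ 2 * (9 * b ^ 2 + 24 * b + 4) ^ 4) * critPoly b) b := by
  have h (c : ℝ) (n : ℕ) : HasDerivAt (fun x : ℝ => c * x ^ n) (c * (n * b ^ (n - 1))) b :=
    (hasDerivAt_pow n b).const_mul c
  have h₁ (c : ℝ) : HasDerivAt (fun x : ℝ => c * x) c b := by
    simpa using (hasDerivAt_id b).const_mul c
  have hg := (((((h 27 5).add (h 54 4)).add (h 1674 3)).add (h 964 2)).add (h₁ 36)).add_const 8
  have hp := (h₁ 3).add_const 2
  have hq := ((h 9 2).add (h₁ 24)).add_const 4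
  have hD := ((hasDerivAt_pow 4 b).mul hp).mul (hq.pow 3)
  refine ((hg.pow 3).div hD ?_).congr_deriv ?_
  · simp only [Pi.mul_apply, Pi.add_apply, Pi.pow_apply]
    positivity
  · have hp₀ : 3 * b + 2 ≠ 0 := by positivity
    have hq₀ : 9 * b ^ 2 + 24 * b + 4 ≠ 0 := by positivity
    simp only [Pi.mul_apply, Pi.add_apply, Pi.pow_apply, critPoly]
    field_simp
    norm_num
    ring

theorem deriv_sasakiEnergy_eq_pos_mul {b : ℝ} (hb : 0 < b) :
    ∃ c, 0 < c ∧ deriv sasakiEnergy b = c * critPoly b :=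
  ⟨_, by positivity, (hasDerivAt_sasakiEnergy hb).deriv⟩

theorem continuousOn_sasakiEnergy : ContinuousOn sasakiEnergy (Ioi 0) := fun _ hb =>
  (hasDerivAt_sasakiEnergy hb).continuousAt.continuousWithinAt

theorem monotoneOn_sasakiEnergy {s : Set ℝ} (hs : Convex ℝ s) (h₀ : s ⊆ Ioi 0)
    (h : ∀ b ∈ interior s, 0 < critPoly b) : MonotoneOn sasakiEnergy s := by
  refine (strictMonoOn_of_deriv_pos hs (continuousOn_sasakiEnergy.mono h₀)
    fun b hb => ?_).monotoneOn
  obtain ⟨c, hc, hd⟩ := deriv_sasakiEnergy_eq_pos_mul (h₀ (interior_subset hb))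
  rw [hd]
  exact mul_pos hc (h b hb)

theorem antitoneOn_sasakiEnergy {s : Set ℝ} (hs : Convex ℝ s) (h₀ : s ⊆ Ioi 0)
    (h : ∀ b ∈ interior s, critPoly b < 0) : AntitoneOn sasakiEnergy s := by
  refine (strictAntiOn_of_deriv_neg hs (continuousOn_sasakiEnergy.mono h₀)
    fun b hb => ?_).antitoneOn
  obtain ⟨c, hc, hd⟩ := deriv_sasakiEnergy_eq_pos_mul (h₀ (interior_subset hb))
  rw [hd]
  exact mul_neg_of_pos_of_neg hc (h b hb)

/-- A continuous function that increases strictly from a negative to a positive value changes sign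
at exactly one point. -/
theorem exists_sign_change_of_strictMonoOn {f : ℝ → ℝ} {u v : ℝ} (huv : u ≤ v)
    (hc : ContinuousOn f (Icc u v)) (hm : StrictMonoOn f (Icc u v)) (hu : f u < 0) (hv : 0 < f v) :
    ∃ c ∈ Ioo u v, f c = 0 ∧ (∀ x ∈ Ico u c, f x < 0) ∧ ∀ x ∈ Ioc c v, 0 < f x := by
  obtain ⟨c, hcm, h₀⟩ := intermediate_value_Ioo huv hc ⟨hu, hv⟩
  have hcI : c ∈ Icc u v := Ioo_subset_Icc_self hcm
  refine ⟨c, hcm, h₀, fun x hx => ?_, fun x hx => ?_⟩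
  · simpa only [h₀] using hm ⟨hx.1, hx.2.le.trans hcm.2.le⟩ hcI hx.2
  · simpa only [h₀] using hm hcI ⟨hcm.1.le.trans hx.1.le, hx.2⟩ hx.1

theorem critPoly_neg_of_mem_Ioo_left {b : ℝ} (hb : b ∈ Ioo (0 : ℝ) (223/500)) :
    critPoly b < 0 := by
  obtain ⟨t, ht⟩ : ∃ t, t = 1000 * b - 0 := ⟨_, rfl⟩
  obtain ⟨s, hs⟩ : ∃ s, s = 446 - 1000 * b := ⟨_, rfl⟩
  have ht₀ : 0 < t := by linarith [hb.1]
  have hs₀ : 0 < s := by linarith [hb.2]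
  have key : -critPoly b = (256 * s ^ 8
        + 448672/125 * t * s ^ 7
        + 11024604/625 * t ^ 2 * s ^ 6
        + 170689987571/3906250 * t ^ 3 * s ^ 5
        + 118110737091569/1953125000 * t ^ 4 * s ^ 4
        + 45674095036668003/976562500000 * t ^ 5 * s ^ 3
        + 72367456301064565447/3906250000000000 * t ^ 6 * s ^ 2
        + 2779368524317877090711/976562500000000000 * t ^ 7 * s
        + 3575812005757912590351/976562500000000000000 * t ^ 8) / 446 ^ 8 := by
    rw [ht, hs, critPoly]
    ring
  rw [← neg_pos, key]
  positivity

theorem critPoly_pos_of_mem_Ioo {b : ℝ} (hb : b ∈ Ioo (447/1000 : ℝ) (73/100)) :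
    0 < critPoly b := by
  obtain ⟨t, ht⟩ : ∃ t, t = 1000 * b - 447 := ⟨_, rfl⟩
  obtain ⟨s, hs⟩ : ∃ s, s = 730 - 1000 * b := ⟨_, rfl⟩
  have ht₀ : 0 < t := by linarith [hb.1]
  have hs₀ : 0 < s := by linarith [hb.2]
  have key : critPoly b = (665117447702986379152169/250000000000000000000000 * s ^ 8
        + 2831638140529929157616323/1562500000000000000000 * t * s ^ 7
        + 8199429012114071216411073/625000000000000000000 * t ^ 2 * s ^ 6
        + 19317438231199895817563/488281250000000000 * t ^ 3 * s ^ 5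
        + 158569915653099193738163/2500000000000000000 * t ^ 4 * s ^ 4
        + 8910586588285418775171/156250000000000000 * t ^ 5 * s ^ 3
        + 1708691993422090142453/62500000000000000 * t ^ 6 * s ^ 2
        + 4336173277992970409/781250000000000 * t ^ 7 * s
        + 159381987201342849/2500000000000000 * t ^ 8) / 283 ^ 8 := by
    rw [ht, hs, critPoly]
    ring
  rw [key]
  positivity

theorem critPoly_neg_of_mem_Ioo_right {b : ℝ} (hb : b ∈ Ioo (37/50 : ℝ) (249/100)) :
    critPoly b < 0 := by
  obtain ⟨t, ht⟩ : ∃ t, t = 100 * b - 74 := ⟨_, rfl⟩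
  obtain ⟨s, hs⟩ : ∃ s, s = 249 - 100 * b := ⟨_, rfl⟩
  have ht₀ : 0 < t := by linarith [hb.1]
  have hs₀ : 0 < s := by linarith [hb.2]
  have key : -critPoly b = (1237904597621991/9765625000000 * s ^ 8
        + 178580128392429889/4882812500000 * t * s ^ 7
        + 6338812086622557073/9765625000000 * t ^ 2 * s ^ 6
        + 89749563753431159067/19531250000000 * t ^ 3 * s ^ 5
        + 259362898708636516717/15625000000000 * t ^ 4 * s ^ 4
        + 2532243705084158814343/78125000000000 * t ^ 5 * s ^ 3
        + 5068491143684934378693/156250000000000 * t ^ 6 * s ^ 2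
        + 4047487558252210280221/312500000000000 * t ^ 7 * s
        + 132844621760270924671/2500000000000000 * t ^ 8) / 175 ^ 8 := by
    rw [ht, hs, critPoly]
    ring
  rw [← neg_pos, key]
  positivity

theorem critPolyDeriv_pos_of_mem_Ioo {b : ℝ} (hb : b ∈ Ioo (223/500 : ℝ) (447/1000)) :
    0 < critPolyDeriv b := by
  obtain ⟨t, ht⟩ : ∃ t, t = 1000 * b - 446 := ⟨_, rfl⟩
  obtain ⟨s, hs⟩ : ∃ s, s = 447 - 1000 * b := ⟨_, rfl⟩
  have ht₀ : 0 < t := by linarith [hb.1]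
  have hs₀ : 0 < s := by linarith [hb.2]
  have key : critPolyDeriv b = (385476741630018748597/61035156250000000 * s ^ 7
        + 21593049925551987285549/488281250000000000 * t * s ^ 6
        + 64798127313732663785679/488281250000000000 * t ^ 2 * s ^ 5
        + 86422700069819318847779/390625000000000000 * t ^ 3 * s ^ 4
        + 21611947613236473790407/97656250000000000 * t ^ 4 * s ^ 3
        + 1037673288364675643788827/7812500000000000000 * t ^ 5 * s ^ 2
        + 345990602392023965043563/7812500000000000000 * t ^ 6 * s
        + 197765531317652285417577/31250000000000000000 * t ^ 7) / 1 ^ 7 := by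
    rw [ht, hs, critPolyDeriv]
    ring
  rw [key]
  positivity

theorem critPolyDeriv_neg_of_mem_Ioo {b : ℝ} (hb : b ∈ Ioo (73/100 : ℝ) (37/50)) :
    critPolyDeriv b < 0 := by
  obtain ⟨t, ht⟩ : ∃ t, t = 100 * b - 73 := ⟨_, rfl⟩
  obtain ⟨s, hs⟩ : ∃ s, s = 74 - 100 * b := ⟨_, rfl⟩
  have ht₀ : 0 < t := by linarith [hb.1]
  have hs₀ : 0 < s := by linarith [hb.2]
  have key : -critPolyDeriv b = (27828397950456631/1562500000000 * s ^ 7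
        + 397189096374917017/3125000000000 * t * s ^ 6
        + 151823649314978811/390625000000 * t ^ 2 * s ^ 5
        + 103155007791907037/156250000000 * t ^ 3 * s ^ 4
        + 13139392201779407/19531250000 * t ^ 4 * s ^ 3
        + 80322220948809771/195312500000 * t ^ 5 * s ^ 2
        + 3409331806277827/24414062500 * t ^ 6 * s
        + 992162914296811/48828125000 * t ^ 7) / 1 ^ 7 := by
    rw [ht, hs, critPolyDeriv]
    ring
  rw [← neg_pos, key]
  positivity

theorem critPolyDeriv_pos_of_lt {b : ℝ} (hb : 249/100 < b) : 0 < critPolyDeriv b := by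
  obtain ⟨t, rfl⟩ : ∃ t, b = t + 249/100 := ⟨b - 249/100, by ring⟩
  have ht : 0 < t := by linarith
  have key : critPolyDeriv (t + 249/100) = 11184694104262683873/1562500000000
        + 1157908535133691753/31250000000 * t
        + 2335235507901477/39062500 * t ^ 2
        + 28918131826203/625000 * t ^ 3
        + 60833215161/3125 * t ^ 4
        + 2819583918/625 * t ^ 5
        + 13226976/25 * t ^ 6
        + 23328 * t ^ 7 := by
    rw [critPolyDeriv]
    ring
  rw [key]
  positivity

theorem exists_critPoly_sign_pattern :
    ∃ b₁ ∈ Ioo (223/500 : ℝ) (447/1000), ∃ b₂ ∈ Ioo (73/100 : ℝ) (37/50),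
      ∃ b₃ ∈ Ioo (249/100 : ℝ) (5/2),
      (critPoly b₁ = 0 ∧ critPoly b₂ = 0 ∧ critPoly b₃ = 0) ∧
      (∀ b ∈ Ioo 0 b₁, critPoly b < 0) ∧ (∀ b ∈ Ioo b₁ b₂, 0 < critPoly b) ∧
      (∀ b ∈ Ioo b₂ b₃, critPoly b < 0) ∧ ∀ b ∈ Ioi b₃, 0 < critPoly b := by
  have hc (s : Set ℝ) : ContinuousOn critPoly s := continuous_critPoly.continuousOn
  have hd (b : ℝ) : deriv critPoly b = critPolyDeriv b := (hasDerivAt_critPoly b).deriv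
  obtain ⟨b₁, h₁, z₁, l₁, r₁⟩ := exists_sign_change_of_strictMonoOn (f := critPoly)
    (u := 223/500) (v := 447/1000) (by norm_num) (hc _)
    (strictMonoOn_of_deriv_pos (convex_Icc _ _) (hc _) fun b hb => by
      rw [interior_Icc] at hb
      rw [hd]
      exact critPolyDeriv_pos_of_mem_Ioo hb)
    (by norm_num [critPoly]) (by norm_num [critPoly])
  obtain ⟨b₂, h₂, z₂, l₂, r₂⟩ := exists_sign_change_of_strictMonoOn (f := fun b => -critPoly b)
    (u := 73/100) (v := 37/50) (by norm_num) (hc _).neg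
    (strictAntiOn_of_deriv_neg (convex_Icc _ _) (hc _) fun b hb => by
      rw [interior_Icc] at hb
      rw [hd]
      exact critPolyDeriv_neg_of_mem_Ioo hb).neg
    (by norm_num [critPoly]) (by norm_num [critPoly])
  have hm₃ : StrictMonoOn critPoly (Ici (249/100)) :=
    strictMonoOn_of_deriv_pos (convex_Ici _) (hc _) fun b hb => by
      rw [interior_Ici] at hb
      rw [hd]
      exact critPolyDeriv_pos_of_lt hb
  obtain ⟨b₃, h₃, z₃, l₃, -⟩ := exists_sign_change_of_strictMonoOn (f := critPoly)
    (u := 249/100) (v := 5/2) (by norm_num) (hc _) (hm₃.mono Icc_subset_Ici_self)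
    (by norm_num [critPoly]) (by norm_num [critPoly])
  simp only [neg_eq_zero, neg_neg_iff_pos, neg_pos] at z₂ l₂ r₂
  refine ⟨b₁, h₁, b₂, h₂, b₃, h₃, ⟨z₁, z₂, z₃⟩, fun b hb => ?_, fun b hb => ?_,
    fun b hb => ?_, fun b hb => ?_⟩
  · rcases lt_or_ge b (223/500) with h | h
    · exact critPoly_neg_of_mem_Ioo_left ⟨hb.1, h⟩
    · exact l₁ b ⟨h, hb.2⟩
  · rcases le_or_gt b (447/1000) with h | h
    · exact r₁ b ⟨hb.1, h⟩
    · rcases lt_or_ge b (73/100) with h' | h'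
      · exact critPoly_pos_of_mem_Ioo ⟨h, h'⟩
      · exact l₂ b ⟨h', hb.2⟩
  · rcases le_or_gt b (37/50) with h | h
    · exact r₂ b ⟨hb.1, h⟩
    · rcases lt_or_ge b (249/100) with h' | h'
      · exact critPoly_neg_of_mem_Ioo_right ⟨h, h'⟩
      · exact l₃ b ⟨h', hb.2⟩
  · simpa only [z₃] using hm₃ (mem_Ici.2 h₃.1.le) (mem_Ici.2 (h₃.1.le.trans (le_of_lt hb))) hb

theorem sasakiEnergy_five_halves_lt {b : ℝ} (hb : b ∈ Ioo (223/500 : ℝ) (447/1000)) :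
    sasakiEnergy (5/2) < sasakiEnergy b := by
  obtain ⟨hl, hu⟩ := hb
  have hb₀ : 0 < b := by linarith
  calc sasakiEnergy (5/2)
      < (27 * (223/500) ^ 5 + 54 * (223/500) ^ 4 + 1674 * (223/500) ^ 3 + 964 * (223/500) ^ 2
          + 36 * (223/500) + 8) ^ 3
        / ((447/1000) ^ 4 * (3 * (447/1000) + 2)
          * (9 * (447/1000) ^ 2 + 24 * (447/1000) + 4) ^ 3) := by
        norm_num [sasakiEnergy]
    _ ≤ sasakiEnergy b := by
        rw [sasakiEnergy]
        gcongr


/-- For `SE(b) = (27b⁵ + 54b⁴ + 1674b³ + 964b² + 36b + 8)³/(b⁴(3b+2)(9b²+24b+4)³)`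
on `(0,∞)`, the critical set of `SE` in `(0,∞)` consists of exactly three points, one
in `(0.44,0.45)`, one in `(0.73,0.74)` and one in `(2.49,2.50)`; the middle one is a
local maximum, the other two are local minima, and the one in `(2.49,2.50)` is the
global minimum of `SE` on `(0,∞)`. -/
theorem stmt_16 (SE : ℝ → ℝ)
    (hSE : ∀ b, SE b = (27 * b ^ 5 + 54 * b ^ 4 + 1674 * b ^ 3 + 964 * b ^ 2
        + 36 * b + 8) ^ 3 / (b ^ 4 * (3 * b + 2) * (9 * b ^ 2 + 24 * b + 4) ^ 3)) :
    ∃ b₁ b₂ b₃ : ℝ,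
      b₁ ∈ Set.Ioo (0.44 : ℝ) 0.45 ∧ b₂ ∈ Set.Ioo (0.73 : ℝ) 0.74 ∧
      b₃ ∈ Set.Ioo (2.49 : ℝ) 2.50 ∧
      {b : ℝ | 0 < b ∧ deriv SE b = 0} = {b₁, b₂, b₃} ∧
      IsLocalMax SE b₂ ∧ IsLocalMin SE b₁ ∧ IsLocalMin SE b₃ ∧
      (∀ b : ℝ, 0 < b → SE b₃ ≤ SE b) := by
  obtain rfl : SE = sasakiEnergy := funext hSE
  obtain ⟨b₁, h₁, b₂, h₂, b₃, h₃, ⟨z₁, z₂, z₃⟩, n₁, p₂, n₃, p₃⟩ := exists_critPoly_sign_pattern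
  have lt₁ : 0 < b₁ := by linarith [h₁.1]
  have lt₁₂ : b₁ < b₂ := by linarith [h₁.2, h₂.1]
  have lt₂₃ : b₂ < b₃ := by linarith [h₂.2, h₃.1]
  have lt₂ : 0 < b₂ := lt₁.trans lt₁₂
  have lt₃ : 0 < b₃ := lt₂.trans lt₂₃
  have anti₁ : AntitoneOn sasakiEnergy (Ioc 0 b₁) :=
    antitoneOn_sasakiEnergy (convex_Ioc _ _) (fun _ hx => hx.1) (by rwa [interior_Ioc])
  have mono₂ : MonotoneOn sasakiEnergy (Icc b₁ b₂) :=
    monotoneOn_sasakiEnergy (convex_Icc _ _) (fun _ hx => lt₁.trans_le hx.1) (by rwa [interior_Icc])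
  have anti₃ : AntitoneOn sasakiEnergy (Icc b₂ b₃) :=
    antitoneOn_sasakiEnergy (convex_Icc _ _) (fun _ hx => lt₂.trans_le hx.1) (by rwa [interior_Icc])
  have mono₃ : MonotoneOn sasakiEnergy (Ici b₃) :=
    monotoneOn_sasakiEnergy (convex_Ici _) (fun _ hx => lt₃.trans_le hx) (by rwa [interior_Ici])
  have le₃₁ : sasakiEnergy b₃ ≤ sasakiEnergy b₁ :=
    (mono₃ self_mem_Ici h₃.2.le h₃.2.le).trans (sasakiEnergy_five_halves_lt h₁).le
  refine ⟨b₁, b₂, b₃, ⟨by linarith [h₁.1], by linarith [h₁.2]⟩,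
    ⟨by linarith [h₂.1], by linarith [h₂.2]⟩, ⟨by linarith [h₃.1], by linarith [h₃.2]⟩, ?_,
    isLocalMax_of_mono_anti lt₁₂ lt₂₃ (mono₂.mono Ioc_subset_Icc_self)
      (anti₃.mono Ico_subset_Icc_self),
    isLocalMin_of_anti_mono lt₁ lt₁₂ anti₁ (mono₂.mono Ico_subset_Icc_self),
    isLocalMin_of_anti_mono lt₂₃ (lt_add_one b₃) (anti₃.mono Ioc_subset_Icc_self)
      (mono₃.mono Ico_subset_Ici_self), fun b hb => ?_⟩
  · ext b
    simp only [mem_ofPred_eq, mem_insert_iff, mem_singleton_iff]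
    constructor
    · rintro ⟨hb, hd⟩
      obtain ⟨c, hc, hd'⟩ := deriv_sasakiEnergy_eq_pos_mul hb
      have hz : critPoly b = 0 := (mul_eq_zero.1 (hd'.symm.trans hd)).resolve_left hc.ne'
      by_contra! hne
      rcases lt_or_gt_of_ne hne.1 with h | h
      · exact (n₁ b ⟨hb, h⟩).ne hz
      rcases lt_or_gt_of_ne hne.2.1 with h' | h'
      · exact (p₂ b ⟨h, h'⟩).ne' hz
      rcases lt_or_gt_of_ne hne.2.2 with h'' | h''
      · exact (n₃ b ⟨h', h''⟩).ne hz
      · exact (p₃ b h'').ne' hz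
    · have crit {x : ℝ} (hx : 0 < x) (hz : critPoly x = 0) : 0 < x ∧ deriv sasakiEnergy x = 0 := by
        obtain ⟨c, -, hd⟩ := deriv_sasakiEnergy_eq_pos_mul hx
        exact ⟨hx, by rw [hd, hz, mul_zero]⟩
      rintro (rfl | rfl | rfl)
      exacts [crit lt₁ z₁, crit lt₂ z₂, crit lt₃ z₃]
  · rcases le_total b b₁ with h | h
    · exact le₃₁.trans (anti₁ ⟨hb, h⟩ ⟨lt₁, le_rfl⟩ h)
    rcases le_total b b₂ with h' | h'
    · exact le₃₁.trans (mono₂ ⟨le_rfl, lt₁₂.le⟩ ⟨h, h'⟩ h)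
    rcases le_total b b₃ with h'' | h''
    · exact anti₃ ⟨h', h''⟩ ⟨lt₂₃.le, le_rfl⟩ h''
    · exact mono₃ self_mem_Ici h'' h''
end
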